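/- Let d, c ≥ 2 and let E : M_d ⊗ M_c → M_d ⊗ M_c be a unital quantum channel which factors as E = E₁ ⊗ E₂ for unital quantum channels E₁ : M_d → M_d and E₂ : M_c → M_c. Then κ(E) ≤ max{2(d−1), 2(c−1)} ≤ dc − 2. Consequently, if a unital channel E on M_D (D = dc) satisfies κ(E) ≥ D − 1, then E cannot be written as a tensor product of two channels acting on any smaller tensor factors of M_D. -/

import Mathlib

open scoped Kronecker ComplexOrder

noncomputable section

/-- The amplification `1_n ⊗ E` of a linear map on matrices, acting on `M_n ⊗ M_ι`. -/
def ampl {ι : Type*} [Fintype ι] (n : ℕ)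
    (E : Module.End ℂ (Matrix ι ι ℂ))
    (A : Matrix (Fin n × ι) (Fin n × ι) ℂ) :
    Matrix (Fin n × ι) (Fin n × ι) ℂ :=
  Matrix.of fun p q => E (Matrix.of fun a b => A (p.1, a) (q.1, b)) p.2 q.2

/-- A quantum channel: completely positive (every amplification preserves positive
semidefiniteness) and trace preserving. -/
def IsQuantumChannel {ι : Type*} [Fintype ι] (E : Module.End ℂ (Matrix ι ι ℂ)) : Prop :=
  (∀ (n : ℕ) (A : Matrix (Fin n × ι) (Fin n × ι) ℂ),
      A.PosSemidef → (ampl n E A).PosSemidef) ∧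
    ∀ x : Matrix ι ι ℂ, (E x).trace = x.trace

/-- The multiplicative domain of a linear map on a matrix algebra. -/
def multDomain {ι : Type*} [Fintype ι] (E : Module.End ℂ (Matrix ι ι ℂ)) :
    Set (Matrix ι ι ℂ) :=
  {x | ∀ y, E (x * y) = E x * E y ∧ E (y * x) = E y * E x}

/-- The multiplicative index: the least `n ≥ 1` from which the chain of multiplicative
domains of the powers of `E` has stabilized. -/
def multIndex {ι : Type*} [Fintype ι] (E : Module.End ℂ (Matrix ι ι ℂ)) : ℕ :=
  sInf {n | 0 < n ∧ ∀ m, n ≤ m → multDomain (E ^ m) = multDomain (E ^ n)}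

/-- The stabilized multiplicative domain `M_{E^∞}`. -/
def stabMultDomain {ι : Type*} [Fintype ι] (E : Module.End ℂ (Matrix ι ι ℂ)) :
    Set (Matrix ι ι ℂ) :=
  ⋂ (n : ℕ) (_ : 0 < n), multDomain (E ^ n)

namespace Matrix

variable {ι : Type*} [Fintype ι] [DecidableEq ι]

theorem IsHermitian.exists_aeval_isStarProjection {h : Matrix ι ι ℂ} (hh : h.IsHermitian)
    (h0 : h ≠ 0) :
    ∃ (μ : ℂ) (P : Polynomial ℂ), μ ≠ 0 ∧ Polynomial.aeval h P ≠ 0 ∧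
      IsStarProjection (Polynomial.aeval h P) ∧
      h * Polynomial.aeval h P = μ • Polynomial.aeval h P ∧
      Polynomial.aeval h P * h = μ • Polynomial.aeval h P := by
  obtain ⟨i, hi⟩ : ∃ i, hh.eigenvalues i ≠ 0 := by
    by_contra! H
    exact h0 (hh.eigenvalues_eq_zero_iff.mp (funext H))
  set ev : ι → ℂ := fun j => (hh.eigenvalues j : ℂ) with hev
  set P : Polynomial ℂ := Lagrange.basis (Finset.univ.image ev) id (ev i) with hP
  set φ := Unitary.conjStarAlgAut ℂ (Matrix ι ι ℂ) hh.eigenvectorUnitary with hφ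
  have hsp : h = φ (diagonal ev) := hh.spectral_theorem
  have hval : ∀ j, P.eval (ev j) = if ev j = ev i then 1 else 0 := by
    intro j
    split_ifs with hj
    · rw [hj]
      exact Lagrange.eval_basis_self (v := id) (Set.injOn_id _)
        (Finset.mem_image_of_mem ev (Finset.mem_univ i))
    · exact Lagrange.eval_basis_of_ne (v := id) (Ne.symm hj)
        (Finset.mem_image_of_mem ev (Finset.mem_univ j))
  have hdiag : Polynomial.aeval (diagonal ev) P =
      diagonal fun j => if ev j = ev i then (1 : ℂ) else 0 := by
    have := Polynomial.aeval_algHom_apply (diagonalAlgHom (n := ι) (α := ℂ) ℂ) ev P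
    simp only [diagonalAlgHom_apply] at this
    rw [this]
    congr 1
    ext j
    rw [← hval j]
    have := Polynomial.aeval_algHom_apply (Pi.evalAlgHom ℂ (fun _ : ι => ℂ) j) ev P
    simp
  have hA : Polynomial.aeval h P = φ (diagonal fun j => if ev j = ev i then (1 : ℂ) else 0) := by
    rw [← hdiag, hsp]
    exact Polynomial.aeval_algHom_apply (φ : Matrix ι ι ℂ →ₐ[ℂ] Matrix ι ι ℂ) _ _
  refine ⟨ev i, P, by simpa [hev] using hi, ?_, ?_, ?_, ?_⟩
  · rw [hA]
    intro H
    have := (map_eq_zero_iff φ φ.injective).mp H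
    have := congrFun (congrFun this i) i
    simp at this
  · rw [hA]
    refine IsStarProjection.map ?_ φ
    rw [isStarProjection_iff']
    constructor
    · rw [diagonal_mul_diagonal]
      simp
    · rw [star_eq_conjTranspose, diagonal_conjTranspose]
      congr 1
      ext j
      simp only [Pi.star_apply]
      split_ifs <;> simp
  · rw [hA]
    nth_rewrite 1 [hsp]
    rw [← map_mul, ← map_smul, diagonal_mul_diagonal, ← diagonal_smul]
    congr 2
    ext j
    by_cases hj : ev j = ev i <;> simp [hj]
  · rw [hA]
    nth_rewrite 1 [hsp]
    rw [← map_mul, ← map_smul, diagonal_mul_diagonal, ← diagonal_smul]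
    congr 2
    ext j
    by_cases hj : ev j = ev i <;> simp [hj]

end Matrix

open Matrix

section ProjectionRank

variable {ι : Type*} [Fintype ι] [DecidableEq ι]

/-- A finite set of nonzero, pairwise orthogonal projections in the algebra `A`. -/
structure IsProjFamily (A : StarSubalgebra ℂ (Matrix ι ι ℂ)) (S : Finset (Matrix ι ι ℂ)) :
    Prop where
  mem : ∀ e ∈ S, e ∈ A
  isStarProjection : ∀ e ∈ S, IsStarProjection e
  ne_zero : ∀ e ∈ S, e ≠ 0
  mul_eq_zero : ∀ e ∈ S, ∀ f ∈ S, e ≠ f → e * f = 0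

variable {A B : StarSubalgebra ℂ (Matrix ι ι ℂ)} {S : Finset (Matrix ι ι ℂ)}

namespace IsProjFamily

theorem mono (hS : IsProjFamily B S) (h : B ≤ A) : IsProjFamily A S :=
  ⟨fun e he => h (hS.mem e he), hS.2, hS.3, hS.4⟩

theorem card_le (hS : IsProjFamily A S) : S.card ≤ Fintype.card ι := by
  have hv : ∀ e : S, ∃ v : ι → ℂ, (e : Matrix ι ι ℂ) *ᵥ v ≠ 0 := by
    intro e
    by_contra! H
    refine hS.ne_zero e e.2 (Matrix.ext_of_mulVec_single fun i => ?_)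
    rw [H, zero_mulVec]
  choose v hv using hv
  have hli : LinearIndependent ℂ fun e : S => (e : Matrix ι ι ℂ) *ᵥ v e := by
    rw [linearIndependent_iff']
    intro s g hg e he
    have h1 := congrArg (fun w => (e : Matrix ι ι ℂ) *ᵥ w) hg
    simp only [mulVec_sum, mulVec_smul, mulVec_mulVec, mulVec_zero] at h1
    rw [Finset.sum_eq_single e, (hS.isStarProjection e e.2).isIdempotentElem.eq] at h1
    · exact (smul_eq_zero.mp h1).resolve_right (hv e)
    · intro f _ hfe
      rw [hS.mul_eq_zero e e.2 f f.2 fun h => hfe (Subtype.ext h.symm), zero_mulVec, smul_zero]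
    · exact fun h => absurd he h
  simpa using hli.fintype_card_le_finrank

end IsProjFamily

/-- The largest number of nonzero, pairwise orthogonal projections in `A`. -/
def projRank (A : StarSubalgebra ℂ (Matrix ι ι ℂ)) : ℕ :=
  sSup {k | ∃ S, IsProjFamily A S ∧ S.card = k}

theorem bddAbove_projFamily_card (A : StarSubalgebra ℂ (Matrix ι ι ℂ)) :
    BddAbove {k | ∃ S, IsProjFamily A S ∧ S.card = k} :=
  ⟨Fintype.card ι, by rintro k ⟨S, hS, rfl⟩; exact hS.card_le⟩

theorem IsProjFamily.card_le_projRank (hS : IsProjFamily A S) : S.card ≤ projRank A :=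
  le_csSup (bddAbove_projFamily_card A) ⟨S, hS, rfl⟩

theorem exists_isProjFamily_card_eq (A : StarSubalgebra ℂ (Matrix ι ι ℂ)) :
    ∃ S, IsProjFamily A S ∧ S.card = projRank A :=
  Nat.sSup_mem (s := {k | ∃ S, IsProjFamily A S ∧ S.card = k})
    ⟨0, ∅, ⟨by simp, by simp, by simp, by simp⟩, rfl⟩ (bddAbove_projFamily_card A)

theorem projRank_le_card (A : StarSubalgebra ℂ (Matrix ι ι ℂ)) : projRank A ≤ Fintype.card ι := by
  obtain ⟨S, hS, h⟩ := exists_isProjFamily_card_eq A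
  exact h ▸ hS.card_le

theorem projRank_mono (h : B ≤ A) : projRank B ≤ projRank A := by
  obtain ⟨S, hS, h'⟩ := exists_isProjFamily_card_eq B
  exact h' ▸ (hS.mono h).card_le_projRank

theorem one_le_projRank [Nonempty ι] (A : StarSubalgebra ℂ (Matrix ι ι ℂ)) : 1 ≤ projRank A := by
  have : IsProjFamily A {1} :=
    ⟨by simp, by simp [IsStarProjection.one], by simp, by simp +contextual⟩
  simpa using this.card_le_projRank

namespace IsProjFamily

theorem isStarProjection_sum (hS : IsProjFamily A S) : IsStarProjection (∑ e ∈ S, e) := by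
  rw [isStarProjection_iff']
  constructor
  · rw [Finset.sum_mul_sum]
    refine Finset.sum_congr rfl fun e he => ?_
    rw [Finset.sum_eq_single_of_mem e he fun f hf hfe => hS.mul_eq_zero e he f hf hfe.symm]
    exact (hS.isStarProjection e he).isIdempotentElem.eq
  · rw [star_sum]
    exact Finset.sum_congr rfl fun e he => (hS.isStarProjection e he).isSelfAdjoint.star_eq

theorem mul_sum_eq (hS : IsProjFamily A S) {e : Matrix ι ι ℂ} (he : e ∈ S) :
    e * ∑ f ∈ S, f = e := by
  rw [Finset.mul_sum,
    Finset.sum_eq_single_of_mem e he fun f hf hfe => hS.mul_eq_zero e he f hf hfe.symm]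
  exact (hS.isStarProjection e he).isIdempotentElem.eq

theorem sum_mul_eq (hS : IsProjFamily A S) {e : Matrix ι ι ℂ} (he : e ∈ S) :
    (∑ f ∈ S, f) * e = e := by
  rw [Finset.sum_mul,
    Finset.sum_eq_single_of_mem e he fun f hf hfe => hS.mul_eq_zero f hf e he hfe]
  exact (hS.isStarProjection e he).isIdempotentElem.eq

theorem sum_eq_one (hS : IsProjFamily A S) (hmax : projRank A ≤ S.card) : ∑ e ∈ S, e = 1 := by
  by_contra H
  set p := 1 - ∑ e ∈ S, e with hp
  have hp0 : p ≠ 0 := fun h => H (sub_eq_zero.mp h).symm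
  have hpS : IsStarProjection p := hS.isStarProjection_sum.one_sub
  have hpe : ∀ e ∈ S, p * e = 0 := fun e he => by rw [hp, sub_mul, hS.sum_mul_eq he]; simp
  have hep : ∀ e ∈ S, e * p = 0 := fun e he => by rw [hp, mul_sub, hS.mul_sum_eq he]; simp
  have hpn : p ∉ S := fun h => hp0 (by rw [← hpS.isIdempotentElem.eq, hpe p h])
  have hfam : IsProjFamily A (insert p S) := by
    refine ⟨?_, ?_, ?_, ?_⟩
    · simp only [Finset.forall_mem_insert]
      exact ⟨sub_mem (one_mem A) (sum_mem hS.mem), hS.mem⟩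
    · simp only [Finset.forall_mem_insert]
      exact ⟨hpS, hS.isStarProjection⟩
    · simp only [Finset.forall_mem_insert]
      exact ⟨hp0, hS.ne_zero⟩
    · simp only [Finset.forall_mem_insert]
      exact ⟨⟨fun h => absurd rfl h, fun e he _ => hpe e he⟩,
        fun e he => ⟨fun _ => hep e he, hS.mul_eq_zero e he⟩⟩
  have := hfam.card_le_projRank
  rw [Finset.card_insert_of_notMem hpn] at this
  omega

theorem eq_of_le (hS : IsProjFamily A S) (hmax : projRank A ≤ S.card) {e p : Matrix ι ι ℂ}
    (he : e ∈ S) (hpA : p ∈ A) (hp : IsStarProjection p) (hp0 : p ≠ 0) (hpe : p * e = p) :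
    p = e := by
  by_contra H
  have heS := hS.isStarProjection e he
  have hep : e * p = p := by
    have := congrArg star hpe
    rwa [star_mul, heS.isSelfAdjoint.star_eq, hp.isSelfAdjoint.star_eq] at this
  set q := e - p with hq
  have hqS : IsStarProjection q := hp.sub_of_mul_eq_left heS hpe
  have hq0 : q ≠ 0 := fun h => H (sub_eq_zero.mp h).symm
  have hpq : p * q = 0 := by rw [hq, mul_sub, hpe, hp.isIdempotentElem.eq, sub_self]
  have hqp : q * p = 0 := by rw [hq, sub_mul, hep, hp.isIdempotentElem.eq, sub_self]
  have hqe : q * e = q := by rw [hq, sub_mul, hpe, heS.isIdempotentElem.eq]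
  have heq : e * q = q := by rw [hq, mul_sub, hep, heS.isIdempotentElem.eq]
  have orth : ∀ r, r * e = r → ∀ f ∈ S.erase e, r * f = 0 := fun r hr f hf => by
    obtain ⟨hfe, hf⟩ := Finset.mem_erase.mp hf
    rw [← hr, mul_assoc, hS.mul_eq_zero e he f hf hfe.symm, mul_zero]
  have orth' : ∀ r, e * r = r → ∀ f ∈ S.erase e, f * r = 0 := fun r hr f hf => by
    obtain ⟨hfe, hf⟩ := Finset.mem_erase.mp hf
    rw [← hr, ← mul_assoc, hS.mul_eq_zero f hf e he hfe, zero_mul]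
  have hqn : q ∉ S.erase e := fun h => hq0 (by rw [← hqS.isIdempotentElem.eq, orth q hqe q h])
  have hpn : p ∉ insert q (S.erase e) := by
    rw [Finset.mem_insert, not_or]
    exact ⟨fun h => hp0 (by rw [← hp.isIdempotentElem.eq]; nth_rewrite 2 [h]; exact hpq),
      fun h => hp0 (by rw [← hp.isIdempotentElem.eq, orth p hpe p h])⟩
  have hfam : IsProjFamily A (insert p (insert q (S.erase e))) := by
    refine ⟨?_, ?_, ?_, ?_⟩
    · simp only [Finset.forall_mem_insert]
      exact ⟨hpA, sub_mem (hS.mem e he) hpA, fun f hf => hS.mem f (Finset.mem_of_mem_erase hf)⟩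
    · simp only [Finset.forall_mem_insert]
      exact ⟨hp, hqS, fun f hf => hS.isStarProjection f (Finset.mem_of_mem_erase hf)⟩
    · simp only [Finset.forall_mem_insert]
      exact ⟨hp0, hq0, fun f hf => hS.ne_zero f (Finset.mem_of_mem_erase hf)⟩
    · simp only [Finset.forall_mem_insert]
      exact ⟨⟨fun h => absurd rfl h, fun _ => hpq, fun f hf _ => orth p hpe f hf⟩,
        ⟨fun _ => hqp, fun h => absurd rfl h, fun f hf _ => orth q hqe f hf⟩,
        fun f hf => ⟨fun _ => orth' p hep f hf, fun _ => orth' q heq f hf,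
          fun g hg => hS.mul_eq_zero f (Finset.mem_of_mem_erase hf) g
            (Finset.mem_of_mem_erase hg)⟩⟩
  have := hfam.card_le_projRank
  rw [Finset.card_insert_of_notMem hpn, Finset.card_insert_of_notMem hqn,
    Finset.card_erase_of_mem he] at this
  have := Finset.card_pos.mpr ⟨e, he⟩
  omega

theorem exists_eq_smul_of_isHermitian (hS : IsProjFamily A S) (hmax : projRank A ≤ S.card)
    {e h : Matrix ι ι ℂ} (he : e ∈ S) (hA : h ∈ A) (hh : h.IsHermitian) (hhe : h * e = h) :
    ∃ c : ℂ, h = c • e := by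
  by_cases h0 : h = 0
  · exact ⟨0, by simp [h0]⟩
  obtain ⟨μ, P, hμ, hP0, hP, hl, hr⟩ := hh.exists_aeval_isStarProjection h0
  have heS := hS.isStarProjection e he
  have heh : e * h = h := by
    have := congrArg star hhe
    rwa [star_mul, heS.isSelfAdjoint.star_eq, star_eq_conjTranspose, hh.eq] at this
  have hPA : Polynomial.aeval h P ∈ A :=
    Algebra.adjoin_le (S := A.toSubalgebra) (Set.singleton_subset_iff.mpr hA)
      (Polynomial.aeval_mem_adjoin_singleton ℂ h)
  have hPe : Polynomial.aeval h P * e = Polynomial.aeval h P := by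
    have : Polynomial.aeval h P = μ⁻¹ • (Polynomial.aeval h P * h) := by
      rw [hr, inv_smul_smul₀ hμ]
    rw [this, smul_mul_assoc, mul_assoc, hhe]
  refine ⟨μ, ?_⟩
  rw [hS.eq_of_le hmax he hPA hP hP0 hPe, hhe] at hl
  exact hl

theorem exists_corner_eq_smul (hS : IsProjFamily A S) (hmax : projRank A ≤ S.card)
    {e x : Matrix ι ι ℂ} (he : e ∈ S) (hx : x ∈ A) : ∃ c : ℂ, e * x * e = c • e := by
  have heS := hS.isStarProjection e he
  have hstar : star e = e := heS.isSelfAdjoint.star_eq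
  have hee : e * e = e := heS.isIdempotentElem.eq
  have key : ∀ y ∈ A, star y = y → ∃ c : ℂ, e * y * e = c • e := fun y hy hys =>
    hS.exists_eq_smul_of_isHermitian hmax he
      (mul_mem (mul_mem (hS.mem e he) hy) (hS.mem e he))
      (by rw [IsHermitian, ← star_eq_conjTranspose, star_mul, star_mul, hstar, hys, mul_assoc])
      (by rw [mul_assoc, hee])
  obtain ⟨a, ha⟩ := key (x + star x) (add_mem hx (star_mem hx)) (by simp [add_comm])
  obtain ⟨b, hb⟩ := key (Complex.I • (x - star x))
    (A.smul_mem (sub_mem hx (star_mem hx)) Complex.I) (by simp [smul_sub, neg_add_eq_sub])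
  refine ⟨2⁻¹ * (a - Complex.I * b), ?_⟩
  have hdec : x = (2⁻¹ : ℂ) • ((x + star x) - Complex.I • (Complex.I • (x - star x))) := by
    rw [smul_smul, Complex.I_mul_I, neg_one_smul, sub_neg_eq_add, add_add_sub_cancel, ← two_smul ℂ,
      inv_smul_smul₀ two_ne_zero]
  conv_lhs => rw [hdec]
  rw [mul_smul_comm, smul_mul_assoc, mul_sub, sub_mul, mul_smul_comm, smul_mul_assoc, ha, hb,
    mul_smul, sub_smul, mul_smul]

end IsProjFamily

open StarSubalgebra in
theorem exists_isStarProjection_mem_centralizer (B : StarSubalgebra ℂ (Matrix ι ι ℂ))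
    (W : Submodule ℂ (EuclideanSpace ℂ ι))
    (hW : ∀ b ∈ B, ∀ w ∈ W, toEuclideanCLM (n := ι) (𝕜 := ℂ) b w ∈ W) :
    ∃ p ∈ centralizer ℂ (B : Set (Matrix ι ι ℂ)), IsStarProjection p ∧
      ∀ w, toEuclideanCLM (n := ι) (𝕜 := ℂ) p w = w ↔ w ∈ W := by
  set φ := toEuclideanCLM (n := ι) (𝕜 := ℂ)
  set p := φ.symm W.starProjection with hp
  have hφp : φ p = W.starProjection := φ.apply_symm_apply _
  have hinj : Function.Injective φ := EquivLike.injective φ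
  have hmul : ∀ a b v, φ (a * b) v = φ a (φ b v) := fun a b v => by rw [map_mul φ]; rfl
  have hps : IsStarProjection p := by
    obtain ⟨h1, h2⟩ := isStarProjection_iff'.mp
      (isStarProjection_starProjection (U := W))
    refine isStarProjection_iff'.mpr ⟨hinj ?_, hinj ?_⟩
    · rw [map_mul φ, hφp, h1]
    · rw [map_star φ, hφp, h2]
  have key : ∀ b ∈ B, p * (b * p) = b * p := fun b hb => by
    apply hinj
    ext1 v
    rw [hmul, hmul, hφp]
    exact Submodule.starProjection_eq_self_iff.mpr
      (hW b hb _ (Submodule.starProjection_apply_mem W v))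
  have comm : ∀ b ∈ B, b * p = p * b := fun b hb => by
    have h := congrArg star (key (star b) (star_mem hb))
    rw [star_mul, star_mul, star_star, hps.isSelfAdjoint.star_eq, mul_assoc, key b hb] at h
    exact h
  refine ⟨p, (mem_centralizer_iff ℂ).mpr fun b hb => ⟨comm b hb, comm _ (star_mem hb)⟩, hps,
    fun w => ?_⟩
  rw [hφp]
  exact Submodule.starProjection_eq_self_iff

open StarSubalgebra in
theorem exists_mul_mul_ne_zero {Q : Finset (Matrix ι ι ℂ)}
    (hQ : IsProjFamily (centralizer ℂ (B : Set (Matrix ι ι ℂ))) Q)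
    (hmax : projRank (centralizer ℂ (B : Set (Matrix ι ι ℂ))) ≤ Q.card)
    {q e f : Matrix ι ι ℂ} (hq : q ∈ Q) (hf : f ∈ B)
    (heq : e * q ≠ 0) (hfq : f * q ≠ 0) : ∃ b ∈ B, e * b * f ≠ 0 := by
  by_contra! H
  set φ := toEuclideanCLM (n := ι) (𝕜 := ℂ)
  have hinj : Function.Injective φ := EquivLike.injective φ
  have hmul : ∀ a b v, φ (a * b) v = φ a (φ b v) := fun a b v => by rw [map_mul φ]; rfl
  have hqS := hQ.isStarProjection q hq
  set W : Submodule ℂ (EuclideanSpace ℂ ι) :=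
    Submodule.span ℂ {w | ∃ b ∈ B, ∃ v, w = φ (b * (f * q)) v} with hWdef
  have hW : ∀ b ∈ B, ∀ w ∈ W, φ b w ∈ W := fun b hb w hw => by
    induction hw using Submodule.span_induction with
    | mem w hw =>
      obtain ⟨b', hb', v, rfl⟩ := hw
      exact Submodule.subset_span ⟨b * b', mul_mem hb hb', v, by rw [mul_assoc b, hmul b]⟩
    | zero => simp
    | add x y _ _ hx hy => rw [map_add]; exact add_mem hx hy
    | smul c x _ hx => rw [map_smul]; exact W.smul_mem c hx
  obtain ⟨p, hp, hpS, hpW⟩ := exists_isStarProjection_mem_centralizer B W hW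
  have hqcomm : ∀ b ∈ B, b * q = q * b := fun b hb =>
    ((mem_centralizer_iff ℂ).mp (hQ.mem q hq) b hb).1
  have hrange : ∀ v, φ p v ∈ W := fun v => (hpW _).mp (by
    rw [← hmul, hpS.isIdempotentElem.eq])
  have hvanish : ∀ a : Matrix ι ι ℂ, (∀ b ∈ B, a * (b * (f * q)) = 0) → a * p = 0 := by
    intro a ha
    apply hinj
    ext1 v
    rw [hmul, map_zero]
    have : ∀ w ∈ W, φ a w = 0 := fun w hw => by
      induction hw using Submodule.span_induction with
      | mem w hw =>
        obtain ⟨b, hb, v, rfl⟩ := hw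
        rw [← hmul, ha b hb, map_zero]
        rfl
      | zero => simp
      | add x y _ _ hx hy => rw [map_add, hx, hy, add_zero]
      | smul c x _ hx => rw [map_smul, hx, smul_zero]
    exact this _ (hrange v)
  have hqp : q * p = p := by
    have : (1 - q) * p = 0 := hvanish _ fun b hb => by
      rw [sub_mul, one_mul, sub_eq_zero, ← mul_assoc b, hqcomm _ (mul_mem hb hf), ← mul_assoc q q,
        hqS.isIdempotentElem.eq]
    rw [sub_mul, one_mul, sub_eq_zero] at this
    exact this.symm
  have hpq : p * q = p := by
    have := congrArg star hqp
    rwa [star_mul, hpS.isSelfAdjoint.star_eq, hqS.isSelfAdjoint.star_eq] at this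
  have hep : e * p = 0 := hvanish e fun b hb => by
    rw [← mul_assoc b, ← mul_assoc, ← mul_assoc, H b hb, zero_mul]
  have hpfq : p * (f * q) = f * q := by
    apply hinj
    ext1 v
    rw [hmul]
    exact (hpW _).mpr (Submodule.subset_span ⟨1, one_mem B, v, by rw [one_mul]⟩)
  obtain ⟨c, hc⟩ := hQ.exists_corner_eq_smul hmax hq hp
  rw [hqp, hpq] at hc
  have hc0 : c ≠ 0 := by
    rintro rfl
    rw [zero_smul] at hc
    exact hfq (by rw [← hpfq, hc, zero_mul])
  rw [hc, mul_smul_comm] at hep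
  exact heq ((smul_eq_zero.mp hep).resolve_left hc0)

open StarSubalgebra in
theorem StarSubalgebra.eq_of_projRank_le (hBA : B ≤ A) (hr : projRank A ≤ projRank B)
    (hc : projRank (centralizer ℂ (B : Set (Matrix ι ι ℂ))) ≤
      projRank (centralizer ℂ (A : Set (Matrix ι ι ℂ)))) : B = A := by
  obtain ⟨S, hS, hScard⟩ := exists_isProjFamily_card_eq B
  obtain ⟨Q, hQ, hQcard⟩ := exists_isProjFamily_card_eq (centralizer ℂ (A : Set (Matrix ι ι ℂ)))
  have hS1 := hS.sum_eq_one hScard.ge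
  have hQ1 := hQ.sum_eq_one hQcard.ge
  have hcorner := fun e (he : e ∈ S) x (hx : x ∈ A) =>
    (hS.mono hBA).exists_corner_eq_smul (hScard ▸ hr) he hx
  refine le_antisymm hBA fun x hx => ?_
  have hx1 : x = ∑ e ∈ S, ∑ f ∈ S, e * x * f := by
    rw [← Finset.sum_mul_sum, hS1]
    simp [← Finset.sum_mul, hS1]
  rw [hx1]
  refine sum_mem fun e he => sum_mem fun f hf => ?_
  by_cases h0 : e * x * f = 0
  · rw [h0]
    exact zero_mem B
  obtain ⟨q, hq, hxq⟩ : ∃ q ∈ Q, e * x * f * q ≠ 0 := by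
    by_contra! H
    exact h0 (by rw [← mul_one (e * x * f), ← hQ1, Finset.mul_sum, Finset.sum_eq_zero H])
  have hqcomm : ∀ a ∈ A, a * q = q * a := fun a ha =>
    ((mem_centralizer_iff ℂ).mp (hQ.mem q hq) a ha).1
  have hfq : f * q ≠ 0 := fun h => hxq (by rw [mul_assoc, h, mul_zero])
  have heq : e * q ≠ 0 := fun h => hxq (by
    rw [mul_assoc e, mul_assoc e, hqcomm _ (mul_mem hx (hBA (hS.mem f hf))), ← mul_assoc, h,
      zero_mul])
  obtain ⟨b, hb, hy0⟩ := exists_mul_mul_ne_zero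
    (hQ.mono (centralizer_le ℂ _ _ hBA)) (hQcard ▸ hc) hq (hS.mem f hf) heq hfq
  have heS := hS.isStarProjection e he
  have hfS := hS.isStarProjection f hf
  set y := e * b * f with hy
  have hyB : y ∈ B := mul_mem (mul_mem (hS.mem e he) hb) (hS.mem f hf)
  have hstar : star y = f * star b * e := by
    rw [hy, star_mul, star_mul, heS.isSelfAdjoint.star_eq, hfS.isSelfAdjoint.star_eq, mul_assoc]
  have hfy : f * star y = star y := by
    rw [hstar, ← mul_assoc, ← mul_assoc, hfS.isIdempotentElem.eq]
  have hye : star y * e = star y := by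
    rw [hstar, mul_assoc, heS.isIdempotentElem.eq]
  have hyf : y * f = y := by rw [hy, mul_assoc, hfS.isIdempotentElem.eq]
  have hey : e * y = y := by rw [hy, ← mul_assoc, ← mul_assoc, heS.isIdempotentElem.eq]
  obtain ⟨c, hc⟩ := hcorner f hf (star y * y) (hBA (mul_mem (star_mem hyB) hyB))
  have hc' : star y * y = c • f := by
    rw [← hc, mul_assoc f, mul_assoc (star y) y f, hyf, ← mul_assoc f (star y) y, hfy]
  have hc0 : c ≠ 0 := by
    rintro rfl
    rw [zero_smul, star_eq_conjTranspose, conjTranspose_mul_self_eq_zero] at hc'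
    exact hy0 hc'
  obtain ⟨l, hl⟩ := hcorner e he (x * f * star y)
    (mul_mem (mul_mem hx (hBA (hS.mem f hf))) (star_mem (hBA hyB)))
  have hfin : c • (e * x * f) = l • y := by
    calc c • (e * x * f) = e * x * f * (c • f) := by
          rw [mul_smul_comm, mul_assoc _ f f, hfS.isIdempotentElem.eq]
      _ = e * (x * f * star y) * e * y := by
          rw [← hc', mul_assoc _ e y, hey]
          simp only [mul_assoc]
      _ = l • y := by rw [hl, smul_mul_assoc, hey]
  have : e * x * f = c⁻¹ • (l • y) := by rw [← hfin, inv_smul_smul₀ hc0]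
  rw [this]
  exact B.smul_mem (B.smul_mem hyB l) c⁻¹

open StarSubalgebra in
/-- A decreasing sequence of *-subalgebras of `M_n` that stabilizes as soon as two consecutive
terms agree is constant from index `2 * (n - 1)` on. -/
theorem StarSubalgebra.eq_of_antitone [Nonempty ι] {C : ℕ → StarSubalgebra ℂ (Matrix ι ι ℂ)}
    (hC : Antitone C) (hstep : ∀ j, C j = C (j + 1) → C (j + 1) = C (j + 2)) {m : ℕ}
    (hm : 2 * (Fintype.card ι - 1) ≤ m) : C m = C (2 * (Fintype.card ι - 1)) := by
  set n := Fintype.card ι with hn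
  have hn1 : 1 ≤ n := Fintype.card_pos
  set r' : ℕ → ℕ := fun j => projRank (centralizer ℂ (C j : Set (Matrix ι ι ℂ))) with hr'
  have hlt : ∀ j, C j ≠ C (j + 1) → projRank (C (j + 1)) + r' j < projRank (C j) + r' (j + 1) := by
    intro j hj
    have hle : C (j + 1) ≤ C j := hC j.le_succ
    have h1 := projRank_mono hle
    have h2 : r' j ≤ r' (j + 1) := projRank_mono (centralizer_le ℂ _ _ hle)
    by_contra! H
    exact hj (StarSubalgebra.eq_of_projRank_le hle (by omega) (by simp only [hr'] at *; omega)).symm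
  obtain ⟨j, hj, hjeq⟩ : ∃ j ≤ 2 * (n - 1), C j = C (j + 1) := by
    by_contra! H
    have hind : ∀ j ≤ 2 * (n - 1) + 1, projRank (C j) + r' 0 + j ≤ projRank (C 0) + r' j := by
      intro j
      induction j with
      | zero => simp
      | succ j ih =>
        intro hj
        have := ih (by omega)
        have := hlt j (H j (by omega))
        omega
    have h1 := hind _ le_rfl
    have h2 := projRank_le_card (C 0)
    have h3 : r' (2 * (n - 1) + 1) ≤ n := projRank_le_card _
    have h4 := one_le_projRank (C (2 * (n - 1) + 1))
    have h5 : 1 ≤ r' 0 := one_le_projRank _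
    omega
  have hconst : ∀ k, C (j + k) = C (j + k + 1) := by
    intro k
    induction k with
    | zero => exact hjeq
    | succ k ih => exact hstep _ ih
  have hall : ∀ k, C (j + k) = C j := by
    intro k
    induction k with
    | zero => rfl
    | succ k ih => rw [← add_assoc, ← hconst k, ih]
  obtain ⟨a, ha⟩ := Nat.exists_eq_add_of_le hj
  obtain ⟨b, hb⟩ := Nat.exists_eq_add_of_le (hj.trans hm)
  rw [ha, hb, hall, hall]

end ProjectionRank

section HilbertSchmidt

/-- The squared Hilbert–Schmidt norm of a matrix. -/
def hsNormSq {ι κ : Type*} [Fintype ι] [Fintype κ] (x : Matrix ι κ ℂ) : ℝ :=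
  ∑ i, ∑ j, ‖x i j‖ ^ 2

variable {ι κ : Type*} [Fintype ι] [Fintype κ]

theorem trace_conjTranspose_mul_self (x : Matrix ι κ ℂ) : (xᴴ * x).trace = (hsNormSq x : ℂ) := by
  simp only [trace, diag_apply, mul_apply, conjTranspose_apply, hsNormSq, Complex.ofReal_sum]
  rw [Finset.sum_comm]
  refine Finset.sum_congr rfl fun i _ => Finset.sum_congr rfl fun j _ => ?_
  rw [Complex.ofReal_pow, ← Complex.conj_mul']
  rfl

theorem hsNormSq_conjTranspose (x : Matrix ι κ ℂ) : hsNormSq xᴴ = hsNormSq x := by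
  simp only [hsNormSq, conjTranspose_apply, norm_star]
  exact Finset.sum_comm

end HilbertSchmidt

theorem Module.End.pow_apply_one {ι : Type*} [DecidableEq ι] {E : Module.End ℂ (Matrix ι ι ℂ)}
    (h1 : E 1 = 1) (n : ℕ) : (E ^ n) 1 = 1 := by
  rw [Module.End.pow_apply]
  exact Function.iterate_fixed h1 n

section Channel

variable {ι : Type*} [Fintype ι] {E G : Module.End ℂ (Matrix ι ι ℂ)}

theorem Matrix.eq_zero_of_posSemidef_smul_add {P R : Matrix ι ι ℂ} (hP : P.IsHermitian)
    (h : ∀ s : ℝ, ((s : ℂ) • P + (s : ℂ) ^ 2 • R).PosSemidef) : P = 0 := by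
  have hv : ∀ v : ι → ℂ, star v ⬝ᵥ (P *ᵥ v) = 0 := by
    intro v
    set p := star v ⬝ᵥ (P *ᵥ v) with hp
    set r := star v ⬝ᵥ (R *ᵥ v) with hr
    have hs : ∀ s : ℝ, 0 ≤ (s : ℂ) * p + (s : ℂ) ^ 2 * r := fun s => by
      have := (h s).dotProduct_mulVec_nonneg v
      rwa [add_mulVec, smul_mulVec, smul_mulVec, dotProduct_add, dotProduct_smul,
        dotProduct_smul, smul_eq_mul, smul_eq_mul] at this
    have hre : ∀ s : ℝ, 0 ≤ s * p.re + s ^ 2 * r.re := fun s => by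
      have := (Complex.le_def.mp (hs s)).1
      rw [← Complex.ofReal_pow, Complex.add_re, Complex.re_ofReal_mul, Complex.re_ofReal_mul] at this
      simpa using this
    have him : ∀ s : ℝ, 0 = s * p.im + s ^ 2 * r.im := fun s => by
      have := (Complex.le_def.mp (hs s)).2
      rw [← Complex.ofReal_pow, Complex.add_im, Complex.im_ofReal_mul, Complex.im_ofReal_mul] at this
      simpa using this
    apply Complex.ext
    · rw [Complex.zero_re]
      have hd : 0 < 1 + |r.re| := by positivity
      have hkey := hre (-p.re / (1 + |r.re|))
      have hle : r.re ≤ |r.re| := le_abs_self _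
      by_contra hne
      have hpos : 0 < p.re ^ 2 := by positivity
      have : -p.re / (1 + |r.re|) * p.re + (-p.re / (1 + |r.re|)) ^ 2 * r.re =
          p.re ^ 2 * (r.re - (1 + |r.re|)) / (1 + |r.re|) ^ 2 := by
        field_simp
        ring
      rw [this] at hkey
      have : p.re ^ 2 * (r.re - (1 + |r.re|)) / (1 + |r.re|) ^ 2 < 0 :=
        div_neg_of_neg_of_pos (mul_neg_of_pos_of_neg hpos (by linarith)) (by positivity)
      linarith
    · rw [Complex.zero_im]
      have h1 := him 1
      have h2 := him (-1)
      linarith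
  have hpos : P.PosSemidef := .of_dotProduct_mulVec_nonneg hP fun v => (hv v).ge
  have hneg : (-P).PosSemidef := .of_dotProduct_mulVec_nonneg hP.neg fun v => by
    rw [neg_mulVec, dotProduct_neg, hv, neg_zero]
  have h2 := hneg.trace_nonneg
  rw [trace_neg, neg_nonneg] at h2
  exact hpos.trace_eq_zero_iff.mp (le_antisymm h2 hpos.trace_nonneg)

namespace IsQuantumChannel

theorem one : IsQuantumChannel (1 : Module.End ℂ (Matrix ι ι ℂ)) :=
  ⟨fun _ _ hA => hA, fun _ => rfl⟩

theorem mul (hE : IsQuantumChannel E) (hG : IsQuantumChannel G) : IsQuantumChannel (E * G) :=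
  ⟨fun n A hA => hE.1 n _ (hG.1 n A hA), fun x => (hE.2 (G x)).trans (hG.2 x)⟩

theorem pow (hE : IsQuantumChannel E) : ∀ n : ℕ, IsQuantumChannel (E ^ n)
  | 0 => one
  | n + 1 => by rw [pow_succ]; exact (hE.pow n).mul hE

theorem trace_sub (hE : IsQuantumChannel E) (x : Matrix ι ι ℂ) :
    (E (xᴴ * x) - (E x)ᴴ * E x).trace = ((hsNormSq x - hsNormSq (E x) : ℝ) : ℂ) := by
  rw [Matrix.trace_sub, hE.2, trace_conjTranspose_mul_self, trace_conjTranspose_mul_self,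
    Complex.ofReal_sub]

variable [DecidableEq ι]

theorem posSemidef_fromBlocks (hE : IsQuantumChannel E) (x : Matrix ι ι ℂ) :
    (fromBlocks (E 1) (E x) (E xᴴ) (E (xᴴ * x))).PosSemidef := by
  have : Invertible (1 : Matrix ι ι ℂ) := invertibleOne
  have hpos : (fromBlocks 1 x xᴴ (xᴴ * x)).PosSemidef := by
    have := (Matrix.PosDef.fromBlocks₁₁ x (xᴴ * x) (PosDef.one (n := ι) (R := ℂ))).mpr (by
      simpa using PosSemidef.zero)
    exact this
  have h := hE.1 2 _ (hpos.submatrix fun p : Fin 2 × ι => if p.1 = 0 then .inl p.2 else .inr p.2)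
  convert h.submatrix (Sum.elim (fun a => (0, a)) fun a => (1, a)) using 1
  ext (i | i) (j | j) <;> rfl

theorem map_conjTranspose (hE : IsQuantumChannel E) (x : Matrix ι ι ℂ) : E xᴴ = (E x)ᴴ :=
  (isHermitian_fromBlocks_iff.mp (hE.posSemidef_fromBlocks x).isHermitian).2.1.symm

theorem posSemidef_sub (hE : IsQuantumChannel E) (h1 : E 1 = 1) (x : Matrix ι ι ℂ) :
    (E (xᴴ * x) - (E x)ᴴ * E x).PosSemidef := by
  have : Invertible (1 : Matrix ι ι ℂ) := invertibleOne
  have h := hE.posSemidef_fromBlocks x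
  rw [h1, hE.map_conjTranspose] at h
  have := (Matrix.PosDef.fromBlocks₁₁ (E x) (E (xᴴ * x)) (PosDef.one (n := ι) (R := ℂ))).mp h
  simpa using this

theorem hsNormSq_le (hE : IsQuantumChannel E) (h1 : E 1 = 1) (x : Matrix ι ι ℂ) :
    hsNormSq (E x) ≤ hsNormSq x := by
  have h := (hE.posSemidef_sub h1 x).trace_nonneg
  rw [hE.trace_sub] at h
  linarith [Complex.zero_le_real.mp h]

theorem map_mul_of_hsNormSq_eq (hE : IsQuantumChannel E) (h1 : E 1 = 1) {x : Matrix ι ι ℂ}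
    (hx : hsNormSq (E x) = hsNormSq x) (y : Matrix ι ι ℂ) : E (y * x) = E y * E x := by
  have h0 : E (xᴴ * x) - (E x)ᴴ * E x = 0 := by
    rw [← (hE.posSemidef_sub h1 x).trace_eq_zero_iff, hE.trace_sub, hx, sub_self, Complex.ofReal_zero]
  set D : Matrix ι ι ℂ → Matrix ι ι ℂ → Matrix ι ι ℂ := fun a b => E (aᴴ * b) - (E a)ᴴ * E b with hD
  have hDH : ∀ a b, (D a b)ᴴ = D b a := fun a b => by
    simp only [hD, conjTranspose_sub, conjTranspose_mul, ← hE.map_conjTranspose,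
      conjTranspose_conjTranspose]
  have key : ∀ z, D x z + D z x = 0 := fun z => by
    refine eq_zero_of_posSemidef_smul_add (R := D z z) ?_ fun s => ?_
    · rw [IsHermitian, conjTranspose_add, hDH, hDH, add_comm]
    · have := hE.posSemidef_sub h1 (x + (s : ℂ) • z)
      have hs : star (s : ℂ) = s := Complex.conj_ofReal s
      convert this using 1
      rw [← sub_eq_zero, ← neg_eq_zero, ← h0]
      simp only [hD, conjTranspose_add, conjTranspose_smul, map_add, map_smul, add_mul, mul_add,
        smul_mul_assoc, mul_smul_comm, hs]
      module
  have hzero : D yᴴ x = 0 := by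
    have h2 := key yᴴ
    have h3 := key (Complex.I • yᴴ)
    have h4 : D x (Complex.I • yᴴ) = Complex.I • D x yᴴ := by
      simp only [hD, map_smul, mul_smul_comm, smul_sub]
    have h5 : D (Complex.I • yᴴ) x = -Complex.I • D yᴴ x := by
      simp only [hD, map_smul, smul_mul_assoc, smul_sub, conjTranspose_smul]
      simp
    rw [h4, h5, neg_smul, ← sub_eq_add_neg, ← smul_sub] at h3
    have h6 := (smul_eq_zero.mp h3).resolve_left Complex.I_ne_zero
    rw [sub_eq_zero.mp h6, ← two_smul ℂ] at h2
    exact (smul_eq_zero.mp h2).resolve_left two_ne_zero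
  simpa only [hD, hE.map_conjTranspose, conjTranspose_conjTranspose, sub_eq_zero] using hzero

theorem mem_multDomain_iff (hE : IsQuantumChannel E) (h1 : E 1 = 1) {x : Matrix ι ι ℂ} :
    x ∈ multDomain E ↔ hsNormSq (E x) = hsNormSq x := by
  constructor
  · intro hx
    have h := hE.trace_sub x
    rw [(hx xᴴ).2, hE.map_conjTranspose, sub_self, trace_zero] at h
    linarith [Complex.ofReal_eq_zero.mp h.symm]
  · intro hx y
    refine ⟨?_, hE.map_mul_of_hsNormSq_eq h1 hx y⟩
    have hx' : hsNormSq (E xᴴ) = hsNormSq xᴴ := by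
      rw [hE.map_conjTranspose, hsNormSq_conjTranspose, hsNormSq_conjTranspose, hx]
    have := congrArg conjTranspose (hE.map_mul_of_hsNormSq_eq h1 hx' yᴴ)
    rwa [← conjTranspose_mul, hE.map_conjTranspose, conjTranspose_conjTranspose,
      hE.map_conjTranspose, hE.map_conjTranspose, ← conjTranspose_mul,
      conjTranspose_conjTranspose] at this

/-- The multiplicative domain of a unital channel as a *-subalgebra. -/
def multDomainStarSubalgebra (hE : IsQuantumChannel E) (h1 : E 1 = 1) :
    StarSubalgebra ℂ (Matrix ι ι ℂ) where
  carrier := multDomain E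
  mul_mem' {a b} ha hb y := by
    constructor
    · rw [mul_assoc, (ha _).1, (hb y).1, (ha b).1, mul_assoc]
    · rw [← mul_assoc, (hb _).2, (ha y).2, (ha b).1, mul_assoc]
  add_mem' {a b} ha hb y := by
    simp only [add_mul, mul_add, map_add, (ha y).1, (ha y).2, (hb y).1, (hb y).2, and_self]
  algebraMap_mem' c y := by
    simp [Algebra.algebraMap_eq_smul_one, h1]
  star_mem' {a} ha := by
    change a ∈ multDomain E at ha
    change aᴴ ∈ multDomain E
    rw [hE.mem_multDomain_iff h1] at ha ⊢
    rw [hE.map_conjTranspose, hsNormSq_conjTranspose, hsNormSq_conjTranspose, ha]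

theorem mem_multDomain_mul_iff (hE : IsQuantumChannel E) (hE1 : E 1 = 1)
    (hG : IsQuantumChannel G) (hG1 : G 1 = 1) {x : Matrix ι ι ℂ} :
    x ∈ multDomain (E * G) ↔ x ∈ multDomain G ∧ G x ∈ multDomain E := by
  rw [(hE.mul hG).mem_multDomain_iff (by rw [Module.End.mul_apply, hG1, hE1]),
    hG.mem_multDomain_iff hG1, hE.mem_multDomain_iff hE1, Module.End.mul_apply]
  have h1 := hG.hsNormSq_le hG1 x
  have h2 := hE.hsNormSq_le hE1 (G x)
  constructor
  · intro h
    constructor <;> linarith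
  · rintro ⟨h, h'⟩
    exact h'.trans h

theorem multDomain_pow_eq [Nonempty ι] (hE : IsQuantumChannel E) (h1 : E 1 = 1) {m : ℕ}
    (hm : 2 * (Fintype.card ι - 1) ≤ m) :
    multDomain (E ^ m) = multDomain (E ^ (2 * (Fintype.card ι - 1))) := by
  have hpow1 : ∀ n, (E ^ n) 1 = 1 := fun n => Module.End.pow_apply_one h1 n
  let C : ℕ → StarSubalgebra ℂ (Matrix ι ι ℂ) := fun n =>
    (hE.pow n).multDomainStarSubalgebra (hpow1 n)
  have hmem : ∀ n x, x ∈ C n ↔ x ∈ multDomain (E ^ n) := fun _ _ => Iff.rfl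
  have hC : Antitone C := antitone_nat_of_succ_le fun n x hx => by
    rw [hmem, pow_succ', hE.mem_multDomain_mul_iff h1 (hE.pow n) (hpow1 n)] at hx
    exact hx.1
  have hstep : ∀ j, C j = C (j + 1) → C (j + 1) = C (j + 2) := fun j hj => by
    have hsucc : ∀ n x, x ∈ C (n + 1) ↔ x ∈ multDomain E ∧ E x ∈ C n := fun n x => by
      rw [hmem, pow_succ, (hE.pow n).mem_multDomain_mul_iff (hpow1 n) hE h1, hmem]
    ext x
    rw [hsucc, hsucc (j + 1), hj]
  exact congrArg SetLike.coe (StarSubalgebra.eq_of_antitone hC hstep hm)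

end IsQuantumChannel

end Channel

section Tensor

variable {ι κ : Type*}

/-- The block of `z` with first indices `i`, `j`. -/
def rightSlice (z : Matrix (ι × κ) (ι × κ) ℂ) (i j : ι) : Matrix κ κ ℂ :=
  .of fun k l => z (i, k) (j, l)

/-- The block of `z` with second indices `k`, `l`. -/
def leftSlice (z : Matrix (ι × κ) (ι × κ) ℂ) (k l : κ) : Matrix ι ι ℂ :=
  .of fun i j => z (i, k) (j, l)

/-- The map `1 ⊗ E₂`. -/
def rightAct (E₂ : Module.End ℂ (Matrix κ κ ℂ)) :
    Module.End ℂ (Matrix (ι × κ) (ι × κ) ℂ) where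
  toFun z := .of fun p q => E₂ (rightSlice z p.1 q.1) p.2 q.2
  map_add' z w := by
    ext p q
    exact congr_fun₂ (map_add E₂ (rightSlice z p.1 q.1) (rightSlice w p.1 q.1)) p.2 q.2
  map_smul' a z := by
    ext p q
    exact congr_fun₂ (map_smul E₂ a (rightSlice z p.1 q.1)) p.2 q.2

/-- The map `E₁ ⊗ 1`. -/
def leftAct (E₁ : Module.End ℂ (Matrix ι ι ℂ)) :
    Module.End ℂ (Matrix (ι × κ) (ι × κ) ℂ) where
  toFun z := .of fun p q => E₁ (leftSlice z p.2 q.2) p.1 q.1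
  map_add' z w := by
    ext p q
    exact congr_fun₂ (map_add E₁ (leftSlice z p.2 q.2) (leftSlice w p.2 q.2)) p.1 q.1
  map_smul' a z := by
    ext p q
    exact congr_fun₂ (map_smul E₁ a (leftSlice z p.2 q.2)) p.1 q.1

theorem rightSlice_rightAct (E₂ : Module.End ℂ (Matrix κ κ ℂ))
    (z : Matrix (ι × κ) (ι × κ) ℂ) (i j : ι) :
    rightSlice (rightAct E₂ z) i j = E₂ (rightSlice z i j) := rfl

theorem leftSlice_leftAct (E₁ : Module.End ℂ (Matrix ι ι ℂ))
    (z : Matrix (ι × κ) (ι × κ) ℂ) (k l : κ) :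
    leftSlice (leftAct E₁ z) k l = E₁ (leftSlice z k l) := rfl

theorem rightAct_kronecker (E₂ : Module.End ℂ (Matrix κ κ ℂ)) (x : Matrix ι ι ℂ)
    (y : Matrix κ κ ℂ) : rightAct E₂ (x ⊗ₖ y) = x ⊗ₖ E₂ y := by
  ext p q
  exact congr_fun₂ (map_smul E₂ (x p.1 q.1) y) p.2 q.2

theorem leftAct_kronecker (E₁ : Module.End ℂ (Matrix ι ι ℂ)) (x : Matrix ι ι ℂ)
    (y : Matrix κ κ ℂ) : leftAct E₁ (x ⊗ₖ y) = E₁ x ⊗ₖ y := by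
  ext p q
  have hslice : leftSlice (x ⊗ₖ y) p.2 q.2 = y p.2 q.2 • x := by
    ext i j
    exact mul_comm _ _
  change E₁ (leftSlice (x ⊗ₖ y) p.2 q.2) p.1 q.1 = _
  rw [hslice, map_smul]
  exact mul_comm _ _

theorem Module.End.pow_apply_kronecker {F : Module.End ℂ (Matrix (ι × κ) (ι × κ) ℂ)}
    {E₁ : Module.End ℂ (Matrix ι ι ℂ)} {E₂ : Module.End ℂ (Matrix κ κ ℂ)}
    (hF : ∀ x y, F (x ⊗ₖ y) = E₁ x ⊗ₖ E₂ y) (n : ℕ) (x : Matrix ι ι ℂ) (y : Matrix κ κ ℂ) :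
    (F ^ n) (x ⊗ₖ y) = (E₁ ^ n) x ⊗ₖ (E₂ ^ n) y := by
  induction n with
  | zero => rfl
  | succ n ih => simp only [pow_succ', Module.End.mul_apply, ih, hF]

theorem leftSlice_rightAct [Fintype κ] [DecidableEq κ] (E₂ : Module.End ℂ (Matrix κ κ ℂ))
    (z : Matrix (ι × κ) (ι × κ) ℂ) (k l : κ) :
    leftSlice (rightAct E₂ z) k l =
      ∑ k', ∑ l', E₂ (single k' l' 1) k l • leftSlice z k' l' := by
  ext i j
  change E₂ (rightSlice z i j) k l = _
  rw [matrix_eq_sum_single (rightSlice z i j)]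
  have hs : ∀ (k' l' : κ) (a : ℂ), single k' l' a = a • single k' l' 1 := fun k' l' a => by
    rw [smul_single, smul_eq_mul, mul_one]
  simp only [hs _ _ (rightSlice z i j _ _), map_sum, map_smul, Matrix.sum_apply, Matrix.smul_apply,
    smul_eq_mul]
  exact Finset.sum_congr rfl fun _ _ => Finset.sum_congr rfl fun _ _ => mul_comm _ _

variable [Fintype ι] [Fintype κ]

theorem hsNormSq_eq_sum_rightSlice (z : Matrix (ι × κ) (ι × κ) ℂ) :
    hsNormSq z = ∑ p : ι × ι, hsNormSq (rightSlice z p.1 p.2) := by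
  simp only [hsNormSq, rightSlice, Fintype.sum_prod_type, of_apply]
  exact Finset.sum_congr rfl fun i _ => Finset.sum_comm

theorem hsNormSq_eq_sum_leftSlice (z : Matrix (ι × κ) (ι × κ) ℂ) :
    hsNormSq z = ∑ p : κ × κ, hsNormSq (leftSlice z p.1 p.2) := by
  simp only [hsNormSq, leftSlice, Fintype.sum_prod_type_right, of_apply]
  refine Eq.trans ?_ Finset.sum_comm
  exact Finset.sum_congr rfl fun k _ => Finset.sum_comm

variable {F : Module.End ℂ (Matrix (ι × κ) (ι × κ) ℂ)}
  {E₁ : Module.End ℂ (Matrix ι ι ℂ)} {E₂ : Module.End ℂ (Matrix κ κ ℂ)}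

theorem eq_leftAct_mul_rightAct [DecidableEq ι] [DecidableEq κ]
    (hF : ∀ x y, F (x ⊗ₖ y) = E₁ x ⊗ₖ E₂ y) :
    F = leftAct E₁ * rightAct E₂ := by
  refine Matrix.ext_linearMap ℂ fun p q => LinearMap.ext_ring ?_
  have hs : single p q (1 : ℂ) = single p.1 q.1 1 ⊗ₖ single p.2 q.2 1 := by
    rw [single_kronecker_single, mul_one]
  change F (single p q 1) = leftAct E₁ (rightAct E₂ (single p q 1))
  rw [hs, hF, rightAct_kronecker, leftAct_kronecker]

theorem eq_rightAct_mul_leftAct [DecidableEq ι] [DecidableEq κ]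
    (hF : ∀ x y, F (x ⊗ₖ y) = E₁ x ⊗ₖ E₂ y) :
    F = rightAct E₂ * leftAct E₁ := by
  refine Matrix.ext_linearMap ℂ fun p q => LinearMap.ext_ring ?_
  have hs : single p q (1 : ℂ) = single p.1 q.1 1 ⊗ₖ single p.2 q.2 1 := by
    rw [single_kronecker_single, mul_one]
  change F (single p q 1) = rightAct E₂ (leftAct E₁ (single p q 1))
  rw [hs, hF, leftAct_kronecker, rightAct_kronecker]

namespace IsQuantumChannel

theorem hsNormSq_rightAct_le [DecidableEq κ] (hE : IsQuantumChannel E₂) (h1 : E₂ 1 = 1)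
    (z : Matrix (ι × κ) (ι × κ) ℂ) : hsNormSq (rightAct E₂ z) ≤ hsNormSq z := by
  rw [hsNormSq_eq_sum_rightSlice, hsNormSq_eq_sum_rightSlice z]
  simp only [rightSlice_rightAct]
  exact Finset.sum_le_sum fun p _ => hE.hsNormSq_le h1 _

theorem hsNormSq_leftAct_le [DecidableEq ι] (hE : IsQuantumChannel E₁) (h1 : E₁ 1 = 1)
    (z : Matrix (ι × κ) (ι × κ) ℂ) : hsNormSq (leftAct E₁ z) ≤ hsNormSq z := by
  rw [hsNormSq_eq_sum_leftSlice, hsNormSq_eq_sum_leftSlice z]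
  simp only [leftSlice_leftAct]
  exact Finset.sum_le_sum fun p _ => hE.hsNormSq_le h1 _

theorem hsNormSq_rightAct_eq_iff [DecidableEq κ] (hE : IsQuantumChannel E₂) (h1 : E₂ 1 = 1)
    {z : Matrix (ι × κ) (ι × κ) ℂ} : hsNormSq (rightAct E₂ z) = hsNormSq z ↔
      ∀ i j, rightSlice z i j ∈ multDomain E₂ := by
  rw [hsNormSq_eq_sum_rightSlice, hsNormSq_eq_sum_rightSlice z]
  simp only [rightSlice_rightAct]
  rw [Finset.sum_eq_sum_iff_of_le fun p _ => hE.hsNormSq_le h1 _]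
  simp only [hE.mem_multDomain_iff h1, Finset.mem_univ, true_imp_iff, Prod.forall]

theorem hsNormSq_leftAct_eq_iff [DecidableEq ι] (hE : IsQuantumChannel E₁) (h1 : E₁ 1 = 1)
    {z : Matrix (ι × κ) (ι × κ) ℂ} : hsNormSq (leftAct E₁ z) = hsNormSq z ↔
      ∀ k l, leftSlice z k l ∈ multDomain E₁ := by
  rw [hsNormSq_eq_sum_leftSlice, hsNormSq_eq_sum_leftSlice z]
  simp only [leftSlice_leftAct]
  rw [Finset.sum_eq_sum_iff_of_le fun p _ => hE.hsNormSq_le h1 _]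
  simp only [hE.mem_multDomain_iff h1, Finset.mem_univ, true_imp_iff, Prod.forall]

theorem mem_multDomain_tensor_iff [DecidableEq ι] [DecidableEq κ]
    (hFc : IsQuantumChannel F) (hF1 : F 1 = 1)
    (hE₁ : IsQuantumChannel E₁) (h₁ : E₁ 1 = 1) (hE₂ : IsQuantumChannel E₂) (h₂ : E₂ 1 = 1)
    (hF : ∀ x y, F (x ⊗ₖ y) = E₁ x ⊗ₖ E₂ y) {z : Matrix (ι × κ) (ι × κ) ℂ} :
    z ∈ multDomain F ↔ (∀ i j, rightSlice z i j ∈ multDomain E₂) ∧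
      ∀ k l, leftSlice z k l ∈ multDomain E₁ := by
  rw [hFc.mem_multDomain_iff hF1, ← hE₂.hsNormSq_rightAct_eq_iff h₂]
  constructor
  · intro hz
    rw [← hE₁.hsNormSq_leftAct_eq_iff h₁]
    constructor
    · refine le_antisymm (hE₂.hsNormSq_rightAct_le h₂ z) ?_
      rw [← hz, eq_leftAct_mul_rightAct hF]
      exact hE₁.hsNormSq_leftAct_le h₁ _
    · refine le_antisymm (hE₁.hsNormSq_leftAct_le h₁ z) ?_
      rw [← hz, eq_rightAct_mul_leftAct hF]
      exact hE₂.hsNormSq_rightAct_le h₂ _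
  · rintro ⟨hr, hl⟩
    rw [← hr, eq_leftAct_mul_rightAct hF, Module.End.mul_apply,
      hE₁.hsNormSq_leftAct_eq_iff h₁]
    intro k l
    rw [leftSlice_rightAct]
    let S := hE₁.multDomainStarSubalgebra h₁
    exact S.sum_mem fun k' _ => S.sum_mem fun l' _ => S.smul_mem (hl k' l') _

theorem multDomain_pow_tensor_eq [DecidableEq ι] [DecidableEq κ]
    [Nonempty ι] [Nonempty κ] (hFc : IsQuantumChannel F)
    (hF1 : F 1 = 1) (hE₁ : IsQuantumChannel E₁) (h₁ : E₁ 1 = 1) (hE₂ : IsQuantumChannel E₂)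
    (h₂ : E₂ 1 = 1) (hF : ∀ x y, F (x ⊗ₖ y) = E₁ x ⊗ₖ E₂ y) {m n : ℕ}
    (hn : max (2 * (Fintype.card ι - 1)) (2 * (Fintype.card κ - 1)) ≤ n) (hm : n ≤ m) :
    multDomain (F ^ m) = multDomain (F ^ n) := by
  obtain ⟨hn₁, hn₂⟩ := max_le_iff.mp hn
  have hmem : ∀ k z, z ∈ multDomain (F ^ k) ↔ (∀ i j, rightSlice z i j ∈ multDomain (E₂ ^ k)) ∧
      ∀ i j, leftSlice z i j ∈ multDomain (E₁ ^ k) := fun k z =>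
    (hFc.pow k).mem_multDomain_tensor_iff (Module.End.pow_apply_one hF1 k) (hE₁.pow k)
      (Module.End.pow_apply_one h₁ k) (hE₂.pow k) (Module.End.pow_apply_one h₂ k)
      (Module.End.pow_apply_kronecker hF k)
  ext z
  rw [hmem, hmem, hE₁.multDomain_pow_eq h₁ (hn₁.trans hm), hE₁.multDomain_pow_eq h₁ hn₁,
    hE₂.multDomain_pow_eq h₂ (hn₂.trans hm), hE₂.multDomain_pow_eq h₂ hn₂]

end IsQuantumChannel

end Tensor

/-- If a unital quantum channel `F` on `M_d ⊗ M_c` (`d, c ≥ 2`) factors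
as a tensor product `E₁ ⊗ E₂` of unital channels, then
`κ(F) ≤ max (2(d-1)) (2(c-1)) ≤ dc - 2`. Consequently, if `κ(F) ≥ dc - 1` then `F`
admits no such tensor factorization. -/
theorem stmt17 (d c : ℕ) (hd : 2 ≤ d) (hc : 2 ≤ c)
    (F : Module.End ℂ (Matrix (Fin d × Fin c) (Fin d × Fin c) ℂ))
    (hF : IsQuantumChannel F) (hFu : F 1 = 1) :
    (∀ (E₁ : Module.End ℂ (Matrix (Fin d) (Fin d) ℂ))
       (E₂ : Module.End ℂ (Matrix (Fin c) (Fin c) ℂ)),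
      IsQuantumChannel E₁ → E₁ 1 = 1 → IsQuantumChannel E₂ → E₂ 1 = 1 →
      (∀ (x : Matrix (Fin d) (Fin d) ℂ) (y : Matrix (Fin c) (Fin c) ℂ),
        F (x ⊗ₖ y) = E₁ x ⊗ₖ E₂ y) →
      multIndex F ≤ max (2 * (d - 1)) (2 * (c - 1)) ∧
        max (2 * (d - 1)) (2 * (c - 1)) ≤ d * c - 2) ∧
    (d * c - 1 ≤ multIndex F →
      ¬ ∃ (E₁ : Module.End ℂ (Matrix (Fin d) (Fin d) ℂ))
          (E₂ : Module.End ℂ (Matrix (Fin c) (Fin c) ℂ)),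
        IsQuantumChannel E₁ ∧ E₁ 1 = 1 ∧ IsQuantumChannel E₂ ∧ E₂ 1 = 1 ∧
        ∀ (x : Matrix (Fin d) (Fin d) ℂ) (y : Matrix (Fin c) (Fin c) ℂ),
          F (x ⊗ₖ y) = E₁ x ⊗ₖ E₂ y) := by
  have hbound : max (2 * (d - 1)) (2 * (c - 1)) ≤ d * c - 2 := by
    obtain ⟨a, rfl⟩ := Nat.exists_eq_add_of_le hd
    obtain ⟨b, rfl⟩ := Nat.exists_eq_add_of_le hc
    have : (2 + a) * (2 + b) = 4 + 2 * a + 2 * b + a * b := by ring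
    omega
  have hindex : ∀ (E₁ : Module.End ℂ (Matrix (Fin d) (Fin d) ℂ))
      (E₂ : Module.End ℂ (Matrix (Fin c) (Fin c) ℂ)),
      IsQuantumChannel E₁ → E₁ 1 = 1 → IsQuantumChannel E₂ → E₂ 1 = 1 →
      (∀ (x : Matrix (Fin d) (Fin d) ℂ) (y : Matrix (Fin c) (Fin c) ℂ),
        F (x ⊗ₖ y) = E₁ x ⊗ₖ E₂ y) →
      multIndex F ≤ max (2 * (d - 1)) (2 * (c - 1)) := by
    intro E₁ E₂ hE₁ h₁ hE₂ h₂ hE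
    have : Nonempty (Fin d) := ⟨⟨0, by omega⟩⟩
    have : Nonempty (Fin c) := ⟨⟨0, by omega⟩⟩
    refine Nat.sInf_le ⟨by omega, fun m hm => ?_⟩
    exact hF.multDomain_pow_tensor_eq hFu hE₁ h₁ hE₂ h₂ hE
      (by simp only [Fintype.card_fin, le_refl]) hm
  refine ⟨fun E₁ E₂ hE₁ h₁ hE₂ h₂ hE => ⟨hindex E₁ E₂ hE₁ h₁ hE₂ h₂ hE, hbound⟩, ?_⟩
  rintro hκ ⟨E₁, E₂, hE₁, h₁, hE₂, h₂, hE⟩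
  have hle := hindex E₁ E₂ hE₁ h₁ hE₂ h₂ hE
  have hdc : 2 * 2 ≤ d * c := Nat.mul_le_mul hd hc
  omega
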